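/- Let g=(g_{jk}) be a smooth map from an open neighborhood U⊂ℝ³ of the segment {(s,0,0):|s|<1} into the symmetric 3×3 real matrices satisfying the Fermi condition (F1). Then at every point (x₁,0,0)∈U one has ∂₂²g₁₃ = −2·∂₂∂₃g₁₂, and also ∂₂²g₂₃ = 0 and ∂₂∂₃g₂₂ = 0. (Derivative identities following from condition (2.6), used in the paper's proof of Proposition 3.2.) -/

import Mathlib

open Set

noncomputable section

/-- Points of `ℝ³` as functions `Fin 3 → ℝ`. -/
abbrev R3 : Type := Fin 3 → ℝ

/-- 3×3 real matrices. -/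
abbrev Mat3 : Type := Matrix (Fin 3) (Fin 3) ℝ

/-- The partial derivative `∂_i f` of a scalar function on `ℝ³`. -/
def pd (i : Fin 3) (f : R3 → ℝ) : R3 → ℝ := fun x => fderiv ℝ f x (Pi.single i 1)

/-- The point `(x₁, 0, 0)` on the axis. -/
def axisPt (x₁ : ℝ) : R3 := ![x₁, 0, 0]

/-- The lowered Christoffel symbols `Γ_{ijk} = (∂_j g_{ik} + ∂_i g_{jk} - ∂_k g_{ij})/2`. -/
def Γlow (g : R3 → Mat3) (i j k : Fin 3) : R3 → ℝ := fun x =>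
  (pd j (fun y => g y i k) x + pd i (fun y => g y j k) x - pd k (fun y => g y i j) x) / 2

/-- The raised Christoffel symbols `Γ_{ij}{}^k = Σ_l Γ_{ijl} g^{lk}`. -/
def Γup (g ginv : R3 → Mat3) (i j k : Fin 3) : R3 → ℝ := fun x =>
  ∑ l : Fin 3, Γlow g i j l x * ginv x l k

/-- Fermi condition (F1) (indices are 0-based: paper's `x₁,x₂,x₃` are `x 0, x 1, x 2`):
`Σ_{k=2}^{3} g_{jk}(x) x_k = x_j` for `j = 2,3` and `Σ_{k=2}^{3} g_{1k}(x) x_k = 0`. -/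
def FermiF1 (g : R3 → Mat3) (U : Set R3) : Prop :=
  ∀ x ∈ U, ∀ j : Fin 3, g x j 1 * x 1 + g x j 2 * x 2 = if j = 0 then 0 else x j

/-- Fermi condition (F2): `g_{jk} = δ_{jk}` and `∂₂ g_{jk} = ∂₃ g_{jk} = 0` on the axis. -/
def FermiF2 (g : R3 → Mat3) (U : Set R3) : Prop :=
  ∀ x₁ : ℝ, axisPt x₁ ∈ U →
    (∀ j k : Fin 3, g (axisPt x₁) j k = if j = k then 1 else 0) ∧
    (∀ j k : Fin 3, pd 1 (fun y => g y j k) (axisPt x₁) = 0 ∧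
      pd 2 (fun y => g y j k) (axisPt x₁) = 0)

/-- `γ` solves the geodesic equation
`d²γ^k/dt² = Σ_{i,j} Γ_{ij}{}^k(γ(t)) (dγ^i/dt)(dγ^j/dt)` on `(-T,T)`. -/
def IsGeodesic (g ginv : R3 → Mat3) (γ : ℝ → R3) (T : ℝ) : Prop :=
  ∀ t ∈ Set.Ioo (-T) T, ∀ k : Fin 3,
    iteratedDeriv 2 γ t k =
      ∑ i : Fin 3, ∑ j : Fin 3, Γup g ginv i j k (γ t) * deriv γ t i * deriv γ t j

theorem contDiffOn_pd {U : Set R3} (hU : IsOpen U) {f : R3 → ℝ}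
    (hf : ContDiffOn ℝ (⊤ : ℕ∞) f U) (i : Fin 3) : ContDiffOn ℝ (⊤ : ℕ∞) (pd i f) U :=
  (hf.fderiv_of_isOpen hU (by norm_cast)).clm_apply contDiffOn_const

theorem differentiableAt_of_contDiffOn_isOpen {U : Set R3} (hU : IsOpen U) {f : R3 → ℝ}
    (hf : ContDiffOn ℝ (⊤ : ℕ∞) f U) {x : R3} (hx : x ∈ U) : DifferentiableAt ℝ f x :=
  (hf.differentiableOn (by simp)).differentiableAt (hU.mem_nhds hx)

theorem pd_add {f h : R3 → ℝ} {x : R3} (hf : DifferentiableAt ℝ f x)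
    (hh : DifferentiableAt ℝ h x) (i : Fin 3) :
    pd i (fun y => f y + h y) x = pd i f x + pd i h x := by
  simp [pd, fderiv_fun_add hf hh]

theorem pd_const_add (k : ℝ) (f : R3 → ℝ) (i : Fin 3) (x : R3) :
    pd i (fun y => k + f y) x = pd i f x := by
  simp [pd]

theorem pd_mul_coord {f : R3 → ℝ} {x : R3} (hf : DifferentiableAt ℝ f x) (i j : Fin 3) :
    pd i (fun y => f y * y j) x = pd i f x * x j + if i = j then f x else 0 := by
  have hj : HasFDerivAt (fun y : R3 => y j) (ContinuousLinearMap.proj (R := ℝ) j) x :=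
    hasFDerivAt_apply j x
  have hd : fderiv ℝ (fun y => f y * y j) x = _ := (hf.hasFDerivAt.fun_mul hj).fderiv
  simp [pd, hd, Pi.single_apply, eq_comm, mul_comm, add_comm]

theorem pd_congr_of_eqOn {U : Set R3} (hU : IsOpen U) {f h : R3 → ℝ} (hfh : EqOn f h U)
    (i : Fin 3) : EqOn (pd i f) (pd i h) U := fun x hx => by
  simp only [pd, (hfh.eventuallyEq_of_mem (hU.mem_nhds hx)).fderiv_eq]

/-- Differentiating a relation `c + a x₂ + b x₃ = 0` gives a relation of the same shape. -/
theorem pd_relation {U : Set R3} (hU : IsOpen U) {a b c : R3 → ℝ}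
    (ha : ContDiffOn ℝ (⊤ : ℕ∞) a U) (hb : ContDiffOn ℝ (⊤ : ℕ∞) b U)
    (hc : ContDiffOn ℝ (⊤ : ℕ∞) c U)
    (h : ∀ x ∈ U, c x + (a x * x 1 + b x * x 2) = 0) (i : Fin 3) :
    ∀ x ∈ U, (pd i c x + ((if i = 1 then a x else 0) + if i = 2 then b x else 0)) +
      (pd i a x * x 1 + pd i b x * x 2) = 0 := by
  intro x hx
  have hax := differentiableAt_of_contDiffOn_isOpen hU ha hx
  have hbx := differentiableAt_of_contDiffOn_isOpen hU hb hx
  have hcx := differentiableAt_of_contDiffOn_isOpen hU hc hx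
  have hd (j : Fin 3) : DifferentiableAt ℝ (fun y : R3 => y j) x := differentiableAt_apply j x
  have key := pd_congr_of_eqOn hU (h := fun _ => 0) h i hx
  rw [pd_add hcx ((hax.fun_mul (hd 1)).fun_add (hbx.fun_mul (hd 2))),
    pd_add (hax.fun_mul (hd 1)) (hbx.fun_mul (hd 2)), pd_mul_coord hax, pd_mul_coord hbx] at key
  have h0 : pd i (fun _ => 0) x = 0 := by simp [pd]
  linarith

/-- The `x₂x₂x₃` and `x₂x₂x₂` Taylor coefficients of the relation `a x₂ + b x₃ = k x_j`. -/
theorem second_pd_of_linear_relation {U : Set R3} (hU : IsOpen U) {a b : R3 → ℝ}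
    (ha : ContDiffOn ℝ (⊤ : ℕ∞) a U) (hb : ContDiffOn ℝ (⊤ : ℕ∞) b U) (k : ℝ) (j : Fin 3)
    (h : ∀ x ∈ U, a x * x 1 + b x * x 2 = k * x j) {s : ℝ} (hs : axisPt s ∈ U) :
    pd 1 (pd 1 b) (axisPt s) = -2 * pd 1 (pd 2 a) (axisPt s) ∧
      pd 1 (pd 1 a) (axisPt s) = 0 := by
  have hL : ContDiffOn ℝ (⊤ : ℕ∞) (fun x : R3 => -k * x j) U := by fun_prop
  have h' : ∀ x ∈ U, -k * x j + (a x * x 1 + b x * x 2) = 0 := fun x hx => by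
    rw [h x hx]; ring
  have hLi (i : Fin 3) (x : R3) : pd i (fun x : R3 => -k * x j) x = if i = j then -k else 0 := by
    rw [pd_mul_coord (f := fun _ => -k) (differentiableAt_const _)]
    simp [pd]
  have step := fun i => pd_relation hU ha hb hL h' i
  simp only [hLi] at step
  have D := fun {f : R3 → ℝ} (hf : ContDiffOn ℝ (⊤ : ℕ∞) f U) =>
    differentiableAt_of_contDiffOn_isOpen hU hf hs
  have S := fun {f : R3 → ℝ} (hf : ContDiffOn ℝ (⊤ : ℕ∞) f U) (i : Fin 3) => contDiffOn_pd hU hf i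
  constructor
  · have e1 := step 2
    simp only [Fin.reduceEq, if_false, if_true, zero_add] at e1
    have e2 := pd_relation hU (S ha 2) (S hb 2) (contDiffOn_const.add hb) e1 1
    simp only [Fin.reduceEq, if_false, if_true, add_zero, pd_const_add] at e2
    have e3 := pd_relation hU (S (S ha 2) 1) (S (S hb 2) 1) ((S hb 1).add (S ha 2)) e2 1 _ hs
    rw [pd_add (D (S hb 1)) (D (S ha 2))] at e3
    simp [axisPt] at e3 ⊢
    linarith
  · have e1 := step 1
    simp only [Fin.reduceEq, if_false, if_true, add_zero] at e1
    have e2 := pd_relation hU (S ha 1) (S hb 1) (contDiffOn_const.add ha) e1 1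
    simp only [Fin.reduceEq, if_false, if_true, add_zero, pd_const_add] at e2
    have e3 := pd_relation hU (S (S ha 1) 1) (S (S hb 1) 1) ((S ha 1).add (S ha 1)) e2 1 _ hs
    rw [pd_add (D (S ha 1)) (D (S ha 1))] at e3
    simp [axisPt] at e3 ⊢
    linarith

/-- derivative identities following from the Fermi condition (F1): at
every axis point, `∂₂²g₁₃ = -2 ∂₂∂₃g₁₂`, `∂₂²g₂₃ = 0` and `∂₂∂₃g₂₂ = 0`
(indices are 0-based, so `g₁₃ = g · 0 2`, etc.). -/
theorem stmt18 (g : R3 → Mat3) (U : Set R3) (hUopen : IsOpen U)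
    (hUseg : ∀ s : ℝ, |s| < 1 → axisPt s ∈ U)
    (hsmooth : ∀ i j : Fin 3, ContDiffOn ℝ (⊤ : ℕ∞) (fun x => g x i j) U)
    (hsym : ∀ x ∈ U, (g x).IsSymm)
    (hF1 : FermiF1 g U) :
    ∀ x₁ : ℝ, axisPt x₁ ∈ U →
      pd 1 (pd 1 (fun y => g y 0 2)) (axisPt x₁) =
        -2 * pd 1 (pd 2 (fun y => g y 0 1)) (axisPt x₁) ∧
      pd 1 (pd 1 (fun y => g y 1 2)) (axisPt x₁) = 0 ∧
      pd 1 (pd 2 (fun y => g y 1 1)) (axisPt x₁) = 0 := by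
  intro s hs
  have h0 := second_pd_of_linear_relation hUopen (hsmooth 0 1) (hsmooth 0 2) 0 0
    (fun x hx => by simpa using hF1 x hx 0) hs
  have h1 := second_pd_of_linear_relation hUopen (hsmooth 1 1) (hsmooth 1 2) 1 1
    (fun x hx => by simpa using hF1 x hx 1) hs
  have h2 := second_pd_of_linear_relation hUopen (hsmooth 1 2) (hsmooth 2 2) 1 2
    (fun x hx => by simpa [(hsym x hx).apply 1 2] using hF1 x hx 2) hs
  exact ⟨h0.1, h2.2, by linarith [h1.1, h2.2]⟩
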